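/- Let V be a finite-dimensional complex inner product space on which a group G acts by unitary operators, and let σ: V → V be a conjugate-linear involutive isometry (a conjugation) commuting with the action of G. Let H ⊆ V be a G-invariant subspace on which G acts irreducibly, and suppose V = H + σ(H). If there exists a G-equivariant complex-linear isomorphism H → σ(H) and H ≠ σ(H), then there exists a G-invariant subspace K ⊆ V on which G acts irreducibly such that σ(K) is orthogonal to K and V is the orthogonal direct sum K ⊕ σ(K). -/

import Mathlib

open scoped ComplexInnerProductSpace

section Conjugation

variable {V : Type*} [NormedAddCommGroup V] [InnerProductSpace ℂ V]

/-- A conjugate-linear isometry conjugates the inner product. -/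
theorem inner_conjugateLinearIsometry_map_map (s : V ≃ₛₗᵢ[starRingEnd ℂ] V) (x y : V) :
    ⟪s x, s y⟫ = starRingEnd ℂ ⟪x, y⟫ := by
  rw [inner_eq_sum_norm_sq_div_four, inner_eq_sum_norm_sq_div_four x y]
  have h₁ : Complex.I • s y = s (-(Complex.I • y)) := by simp [map_smulₛₗ]
  simp only [RCLike.I_to_complex, h₁, ← map_add, ← map_sub, s.norm_map, sub_neg_eq_add,
    ← sub_eq_add_neg]
  simp only [map_div₀, map_add, map_sub, map_mul, map_pow, Complex.coe_algebraMap,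
    Complex.conj_ofReal, Complex.conj_I, Complex.conj_ofNat]
  ring

/-- A conjugate-linear bijection preserves the dimension of subspaces. -/
theorem finrank_map_conjugateLinearIsometry (s : V ≃ₛₗᵢ[starRingEnd ℂ] V) (W : Submodule ℂ V) :
    Module.finrank ℂ (W.map s.toLinearEquiv.toLinearMap) = Module.finrank ℂ W := by
  have e := s.toLinearEquiv.submoduleMap W
  exact (congrArg Cardinal.toNat (rank_eq_of_equiv_equiv (starRingEnd ℂ) e.toAddEquiv
    (star_involutive (R := ℂ)).bijective fun r m ↦ e.map_smulₛₗ r m)).symm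

variable [FiniteDimensional ℂ V]

/-- A linear isometry preserving a finite-dimensional subspace commutes with the orthogonal
projection onto it. -/
theorem starProjection_apply_of_map_le (f : V →ₗᵢ[ℂ] V) {H : Submodule ℂ V}
    (hf : ∀ v ∈ H, f v ∈ H) (v : V) : H.starProjection (f v) = f (H.starProjection v) := by
  have hmap : H.map f.toLinearMap = H :=
    Submodule.eq_of_le_of_finrank_eq (Submodule.map_le_iff_le_comap.2 hf)
      (LinearEquiv.finrank_eq (H.equivMapOfInjective f.toLinearMap f.injective).symm)
  refine Submodule.eq_starProjection_of_mem_of_inner_eq_zero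
    (hf _ (H.starProjection_apply_mem v)) fun w hw ↦ ?_
  rw [← hmap] at hw
  obtain ⟨w, hw, rfl⟩ := hw
  rw [← map_sub]
  exact (f.inner_map_map _ _).trans (H.starProjection_inner_eq_zero v w hw)

/-- A nonzero symmetric operator has a nonzero eigenvalue. -/
theorem LinearMap.IsSymmetric.exists_eigenspace_ne_bot {B : V →ₗ[ℂ] V} (hB : B.IsSymmetric)
    (hB0 : B ≠ 0) : ∃ r : ℝ, r ≠ 0 ∧ Module.End.eigenspace B (r : ℂ) ≠ ⊥ := by
  by_contra! h
  refine hB0 ((hB.eigenvectorBasis rfl).toBasis.ext fun i ↦ ?_)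
  have hv := hB.hasEigenvector_eigenvectorBasis rfl i
  by_cases hr : hB.eigenvalues rfl i = 0
  · simp [hr, hB.apply_eigenvectorBasis rfl i]
  · exact absurd (h _ hr) (Module.End.hasEigenvalue_of_hasEigenvector hv)

end Conjugation

/-- Let `G` act unitarily on a finite-dimensional complex inner product space `V`
equipped with a conjugation `σ` commuting with the `G`-action, and let `H` be an
irreducible `G`-invariant subspace with `V = H + σ(H)`.  If the actions of `G` on `H`
and on `σ(H)` are equivalent and `H ≠ σ(H)`, then there is an irreducible
`G`-invariant subspace `K` of `V` with `K ⟂ σ(K)` and `V = K ⊕ σ(K)` as an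
orthogonal direct sum. -/
theorem exists_orthogonal_conjugate_invariant_subspace
    {G : Type*} [Group G]
    {V : Type*} [NormedAddCommGroup V] [InnerProductSpace ℂ V] [FiniteDimensional ℂ V]
    (ρ : Representation ℂ G V)
    (hunitary : ∀ (g : G) (v : V), ‖ρ g v‖ = ‖v‖)
    (σ : V → V)
    (hσinv : ∀ v, σ (σ v) = v)
    (hσadd : ∀ v w, σ (v + w) = σ v + σ w)
    (hσsmul : ∀ (c : ℂ) (v : V), σ (c • v) = (starRingEnd ℂ c) • σ v)
    (hσnorm : ∀ v, ‖σ v‖ = ‖v‖)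
    (hσcomm : ∀ (g : G) (v : V), σ (ρ g v) = ρ g (σ v))
    (H : Submodule ℂ V) (hHne : H ≠ ⊥)
    (hHinv : ∀ (g : G), ∀ v ∈ H, ρ g v ∈ H)
    (hHirr : ∀ W : Submodule ℂ V, W ≤ H → (∀ (g : G), ∀ v ∈ W, ρ g v ∈ W) →
      W = ⊥ ∨ W = H)
    (hsum : ∀ v : V, ∃ h ∈ H, ∃ h' ∈ H, v = h + σ h')
    (Hσ : Submodule ℂ V) (hHσ : (Hσ : Set V) = σ '' (H : Set V))
    (hne : H ≠ Hσ)
    (hequiv : ∃ e : H ≃ₗ[ℂ] Hσ, ∀ (g : G) (v : H),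
      (e ⟨ρ g v.1, hHinv g v.1 v.2⟩ : V) = ρ g (e v : V)) :
    ∃ K : Submodule ℂ V, K ≠ ⊥ ∧
      (∀ (g : G), ∀ v ∈ K, ρ g v ∈ K) ∧
      (∀ W : Submodule ℂ V, W ≤ K → (∀ (g : G), ∀ v ∈ W, ρ g v ∈ W) →
        W = ⊥ ∨ W = K) ∧
      (∀ k ∈ K, ∀ k' ∈ K, ⟪k, σ k'⟫ = 0) ∧
      (∀ v : V, ∃ k ∈ K, ∃ k' ∈ K, v = k + σ k') := by
  let s : V ≃ₛₗᵢ[starRingEnd ℂ] V :=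
    { toFun := σ
      invFun := σ
      left_inv := hσinv
      right_inv := hσinv
      map_add' := hσadd
      map_smul' := hσsmul
      norm_map' := hσnorm }
  have hσinner : ∀ x y, ⟪σ x, σ y⟫ = starRingEnd ℂ ⟪x, y⟫ :=
    inner_conjugateLinearIsometry_map_map s
  have hσswap : ∀ x y, ⟪σ x, y⟫ = ⟪σ y, x⟫ := fun x y ↦ by
    rw [← inner_conj_symm (σ y) x, ← hσinner, hσinv]
  have hσswap' : ∀ x y, ⟪x, σ y⟫ = ⟪y, σ x⟫ := fun x y ↦ by
    rw [← inner_conj_symm y, ← hσinner, hσinv]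
  let P : V →ₗ[ℂ] V := H.starProjection.toLinearMap
  have hPρ : ∀ g v, P (ρ g v) = ρ g (P v) := fun g v ↦
    starProjection_apply_of_map_le ⟨ρ g, hunitary g⟩ (hHinv g) v
  have hPmem : ∀ v, P v ∈ H := H.starProjection_apply_mem
  have hPself : ∀ v, P v = v ↔ v ∈ H := fun v ↦ H.starProjection_eq_self_iff
  have hPsymm : P.IsSymmetric := H.starProjection_isSymmetric
  -- the difference of the orthogonal projections onto `H` and `σ(H)`
  let B : V →ₗ[ℂ] V := P - s.toLinearEquiv.toLinearMap ∘ₛₗ P ∘ₛₗ s.toLinearEquiv.toLinearMap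
  have hB : ∀ v, B v = P v - σ (P (σ v)) := fun _ ↦ rfl
  have hBσ : ∀ v, B (σ v) = -σ (B v) := fun v ↦ by
    have hsub : σ (P v - σ (P (σ v))) = σ (P v) - σ (σ (P (σ v))) := map_sub s _ _
    rw [hB, hB, hsub, hσinv, hσinv, neg_sub]
  have hBρ : ∀ g v, B (ρ g v) = ρ g (B v) := fun g v ↦ by
    simp only [hB, hσcomm, hPρ, map_sub]
  have hBsymm : B.IsSymmetric := fun x y ↦ by
    simp only [hB, inner_sub_left, inner_sub_right]
    rw [hPsymm x y, hσswap, ← hPsymm (σ y), hσswap' x]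
  have hB0 : B ≠ 0 := fun h ↦ by
    have hσH : ∀ v ∈ H, σ v ∈ H := fun v hv ↦ by
      have := hB (σ v)
      rw [h, LinearMap.zero_apply, hσinv, (hPself v).2 hv] at this
      exact (hPself _).1 (sub_eq_zero.1 this.symm)
    apply hne
    apply SetLike.coe_injective
    rw [hHσ]
    ext v
    exact ⟨fun hv ↦ ⟨σ v, hσH v hv, hσinv v⟩, fun ⟨w, hw, hwv⟩ ↦ hwv ▸ hσH w hw⟩
  obtain ⟨r, hr, hK⟩ := hBsymm.exists_eigenspace_ne_bot hB0
  set K := Module.End.eigenspace B (r : ℂ)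
  have hKmem : ∀ v, v ∈ K ↔ B v = (r : ℂ) • v := fun v ↦ Module.End.mem_eigenspace_iff
  have hKinv : ∀ g, ∀ v ∈ K, ρ g v ∈ K := fun g v hv ↦ by
    rw [hKmem] at hv ⊢
    rw [hBρ, hv, map_smul]
  have hKorth : ∀ k ∈ K, ∀ k' ∈ K, ⟪k, σ k'⟫ = 0 := fun k hk k' hk' ↦ by
    have h := hBsymm k (σ k')
    rw [hBσ, (hKmem k).1 hk, (hKmem k').1 hk', hσsmul, Complex.conj_ofReal, inner_smul_left,
      Complex.conj_ofReal, inner_neg_right, inner_smul_right] at h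
    have h' : (2 * r : ℂ) * ⟪k, σ k'⟫ = 0 := by linear_combination h
    simpa [hr] using h'
  let S : Submodule ℂ V → Submodule ℂ V := fun W ↦ W.map s.toLinearEquiv.toLinearMap
  have hS : ∀ W, Module.finrank ℂ (S W) = Module.finrank ℂ W :=
    finrank_map_conjugateLinearIsometry s
  have hSmem : ∀ {W : Submodule ℂ V} {w}, w ∈ W → σ w ∈ S W :=
    fun {W} {w} hw ↦ Submodule.mem_map_of_mem (f := s.toLinearEquiv.toLinearMap) hw
  -- an invariant subspace is orthogonal to `H` or at least as large as `H`
  have hdich : ∀ W : Submodule ℂ V, (∀ g, ∀ v ∈ W, ρ g v ∈ W) →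
      (∀ w ∈ W, P w = 0) ∨ Module.finrank ℂ H ≤ Module.finrank ℂ W := fun W hW ↦ by
    rcases hHirr (W.map P) (Submodule.map_le_iff_le_comap.2 fun w _ ↦ hPmem w) (by
      rintro g _ ⟨w, hw, rfl⟩
      exact ⟨ρ g w, hW g w hw, hPρ g w⟩) with h | h
    · exact .inl fun w hw ↦ (Submodule.mem_bot ℂ).1 (h ▸ Submodule.mem_map_of_mem hw)
    · exact .inr (h ▸ Submodule.finrank_map_le P W)
  have hlarge : ∀ W : Submodule ℂ V, (∀ g, ∀ v ∈ W, ρ g v ∈ W) → W ≠ ⊥ →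
      Module.finrank ℂ H ≤ Module.finrank ℂ W := fun W hW hWne ↦ by
    rcases hdich W hW with h | h
    · rcases hdich (S W) (by
        rintro g _ ⟨w, hw, rfl⟩
        exact ⟨ρ g w, hW g w hw, hσcomm g w⟩) with h' | h'
      · refine absurd ((Submodule.eq_bot_iff W).2 fun w hw ↦ ?_) hWne
        obtain ⟨a, ha, b, hb, hab⟩ := hsum w
        have h₁ : ⟪a, w⟫ = 0 := by
          rw [← (hPself a).2 ha, hPsymm, h w hw, inner_zero_right]
        have h₂ : ⟪σ b, w⟫ = 0 := by
          rw [hσswap, ← (hPself b).2 hb, ← hPsymm, h' _ (hSmem hw), inner_zero_left]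
        rw [← inner_self_eq_zero (𝕜 := ℂ)]
        nth_rw 1 [hab]
        rw [inner_add_left, h₁, h₂, add_zero]
      · exact hS W ▸ h'
    · exact h
  have hVle : Module.finrank ℂ V ≤ 2 * Module.finrank ℂ H := by
    have htop : H ⊔ S H = ⊤ := Submodule.eq_top_iff'.2 fun v ↦ by
      obtain ⟨a, ha, b, hb, rfl⟩ := hsum v
      exact Submodule.add_mem_sup ha (hSmem hb)
    have := Submodule.finrank_add_le_finrank_add_finrank H (S H)
    rw [htop, finrank_top, hS] at this
    omega
  have hinf : K ⊓ S K = ⊥ := (Submodule.eq_bot_iff _).2 fun v hv ↦ by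
    obtain ⟨hv, k, hk, rfl⟩ := hv
    exact inner_self_eq_zero.1 (hKorth _ hv k hk)
  have hKsup := Submodule.finrank_sup_add_finrank_inf_eq K (S K)
  rw [hinf, finrank_bot, hS] at hKsup
  have hsup_le := (K ⊔ S K).finrank_le
  have hKge := hlarge K hKinv hK
  refine ⟨K, hK, hKinv, fun W hWK hW ↦ ?_, hKorth, fun v ↦ ?_⟩
  · refine or_iff_not_imp_left.2 fun hWne ↦ Submodule.eq_of_le_of_finrank_le hWK ?_
    have := hlarge W hW hWne
    omega
  · have htop : K ⊔ S K = ⊤ := Submodule.eq_top_of_finrank_eq (by omega)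
    obtain ⟨k, hk, _, ⟨k', hk', rfl⟩, hv⟩ :=
      Submodule.mem_sup.1 (htop ▸ Submodule.mem_top : v ∈ K ⊔ S K)
    exact ⟨k, hk, k', hk', hv.symm⟩
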